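/- If a labelled open graph has a Pauli flow, then it has a maximally delayed, focussed Pauli flow. -/

import Mathlib

open scoped symmDiff

inductive MeasLabel : Type
  | XY | XZ | YZ | X | Y | Z
deriving DecidableEq

/-- A labelled open graph: a finite simple graph with input and output sets and a
measurement labelling (only its values on non-outputs are ever used). -/
structure LOG (V : Type) [Fintype V] where
  G : SimpleGraph V
  I : Set V
  O : Set V
  lam : V → MeasLabel

namespace LOG

variable {V : Type} [Fintype V]

/-- The odd neighbourhood of `A`: vertices with an odd number of neighbours in `A`. -/
def odd (G : SimpleGraph V) (A : Set V) : Set V :=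
  {w | Odd ((G.neighborSet w ∩ A).ncard)}

/-- `v` is a measured (non-output) vertex whose label lies in `s`.  (The labelling of a
labelled open graph is only defined on non-outputs.) -/
def labIn (Γ : LOG V) (v : V) (s : Set MeasLabel) : Prop :=
  v ∉ Γ.O ∧ Γ.lam v ∈ s

/-- The Pauli flow conditions for a map `p` and a strict partial order `prec` (`≺`). -/
structure IsPauliFlow (Γ : LOG V) (p : V → Set V) (prec : V → V → Prop) : Prop where
  irrefl : ∀ a, ¬ prec a a
  trans : ∀ a b c, prec a b → prec b c → prec a c
  psub : ∀ u, u ∉ Γ.O → ∀ v ∈ p u, v ∉ Γ.I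
  pf1 : ∀ u, u ∉ Γ.O → ∀ v ∈ p u, u ≠ v →
    ¬ Γ.labIn v {MeasLabel.X, MeasLabel.Y} → prec u v
  pf2 : ∀ u, u ∉ Γ.O → ∀ v ∈ odd Γ.G (p u), u ≠ v →
    ¬ Γ.labIn v {MeasLabel.Y, MeasLabel.Z} → prec u v
  pf3 : ∀ u, u ∉ Γ.O → ∀ v, ¬ prec u v → u ≠ v →
    Γ.labIn v {MeasLabel.Y} → (v ∈ p u ↔ v ∈ odd Γ.G (p u))
  pf4 : ∀ u, u ∉ Γ.O → Γ.lam u = MeasLabel.XY → u ∉ p u ∧ u ∈ odd Γ.G (p u)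
  pf5 : ∀ u, u ∉ Γ.O → Γ.lam u = MeasLabel.XZ → u ∈ p u ∧ u ∈ odd Γ.G (p u)
  pf6 : ∀ u, u ∉ Γ.O → Γ.lam u = MeasLabel.YZ → u ∈ p u ∧ u ∉ odd Γ.G (p u)
  pf7 : ∀ u, u ∉ Γ.O → Γ.lam u = MeasLabel.X → u ∈ odd Γ.G (p u)
  pf8 : ∀ u, u ∉ Γ.O → Γ.lam u = MeasLabel.Z → u ∈ p u
  pf9 : ∀ u, u ∉ Γ.O → Γ.lam u = MeasLabel.Y →
    ((u ∈ p u ∧ u ∉ odd Γ.G (p u)) ∨ (u ∉ p u ∧ u ∈ odd Γ.G (p u)))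

/-- `phat` is focussed over `S`. -/
def FocussedOver (Γ : LOG V) (phat S : Set V) : Prop :=
  (∀ w ∈ S ∩ phat, Γ.lam w ∈ ({MeasLabel.XY, MeasLabel.X, MeasLabel.Y} : Set MeasLabel)) ∧
  (∀ w ∈ S ∩ odd Γ.G phat,
    Γ.lam w ∈ ({MeasLabel.XZ, MeasLabel.YZ, MeasLabel.Y, MeasLabel.Z} : Set MeasLabel)) ∧
  (∀ w ∈ S, Γ.lam w = MeasLabel.Y → (w ∈ phat ↔ w ∈ odd Γ.G phat))

/-- A focussed set for `Γ`: a subset of the non-inputs that is focussed over all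
non-outputs. -/
def IsFocussedSet (Γ : LOG V) (phat : Set V) : Prop :=
  (∀ v ∈ phat, v ∉ Γ.I) ∧ FocussedOver Γ phat {v | v ∉ Γ.O}

/-- A Pauli flow map `p` is focussed if each `p v` is focussed over the measured
vertices other than `v`. -/
def IsFocussed (Γ : LOG V) (p : V → Set V) : Prop :=
  ∀ v, v ∉ Γ.O → FocussedOver Γ (p v) ({w | w ∉ Γ.O} \ {v})

/-- `Vcum prec k` is `V_{∪k}^≺`, the union of the layers up to depth `k`. -/
def Vcum (prec : V → V → Prop) : ℕ → Set V
  | 0 => {v | ∀ w, ¬ prec v w}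
  | k + 1 => Vcum prec k ∪ {v | v ∉ Vcum prec k ∧ ∀ w, w ∉ Vcum prec k → ¬ prec v w}

/-- `Vlayer prec k` is `V_k^≺`, the `≺`-maximal elements among the vertices not of
smaller depth. -/
def Vlayer (prec : V → V → Prop) : ℕ → Set V
  | 0 => {v | ∀ w, ¬ prec v w}
  | k + 1 => {v | v ∉ Vcum prec k ∧ ∀ w, w ∉ Vcum prec k → ¬ prec v w}

/-- `prec` is more delayed than `prec'`. -/
def MoreDelayed (prec prec' : V → V → Prop) : Prop :=
  (∀ k, (Vcum prec' k).ncard ≤ (Vcum prec k).ncard) ∧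
  ∃ k, (Vcum prec' k).ncard < (Vcum prec k).ncard

/-- A maximally delayed Pauli flow: no Pauli flow for the same labelled open graph is
more delayed. -/
def IsMaxDelayed (Γ : LOG V) (p : V → Set V) (prec : V → V → Prop) : Prop :=
  IsPauliFlow Γ p prec ∧
  ∀ q prec', IsPauliFlow Γ q prec' → ¬ MoreDelayed prec' prec

/-- `Λ_u^P`: the measured vertices other than `u` whose label is `P`. -/
def LamP (Γ : LOG V) (u : V) (P : MeasLabel) : Set V :=
  {v | v ∉ Γ.O ∧ v ≠ u ∧ Γ.lam v = P}

/-- `V_{k+1}^{≺,XY}` where `A = V_{∪k}^≺`. -/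
def VXY (Γ : LOG V) (A : Set V) : Set V :=
  {u | u ∉ Γ.O ∧ Γ.lam u ∈ ({MeasLabel.XY, MeasLabel.X, MeasLabel.Y} : Set MeasLabel) ∧
    ∃ K, K ⊆ (A ∪ LamP Γ u MeasLabel.X ∪ LamP Γ u MeasLabel.Y) ∩ {v | v ∉ Γ.I} ∧
      (K ∩ LamP Γ u MeasLabel.Y) \ A = (odd Γ.G K ∩ LamP Γ u MeasLabel.Y) \ A ∧
      odd Γ.G K \ (A ∪ LamP Γ u MeasLabel.Y ∪ LamP Γ u MeasLabel.Z) = {u}}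

/-- `V_{k+1}^{≺,XZ}` where `A = V_{∪k}^≺`. -/
def VXZ (Γ : LOG V) (A : Set V) : Set V :=
  {u | u ∉ Γ.O ∧ Γ.lam u ∈ ({MeasLabel.XZ, MeasLabel.X, MeasLabel.Z} : Set MeasLabel) ∧
    ∃ K, K ⊆ (A ∪ LamP Γ u MeasLabel.X ∪ LamP Γ u MeasLabel.Y) ∩ {v | v ∉ Γ.I} ∧
      (K ∩ LamP Γ u MeasLabel.Y) \ A = (odd Γ.G (K ∪ {u}) ∩ LamP Γ u MeasLabel.Y) \ A ∧
      odd Γ.G (K ∪ {u}) \ (A ∪ LamP Γ u MeasLabel.Y ∪ LamP Γ u MeasLabel.Z) = {u}}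

/-- `V_{k+1}^{≺,YZ}` where `A = V_{∪k}^≺`. -/
def VYZ (Γ : LOG V) (A : Set V) : Set V :=
  {u | u ∉ Γ.O ∧ Γ.lam u ∈ ({MeasLabel.YZ, MeasLabel.Y, MeasLabel.Z} : Set MeasLabel) ∧
    ∃ K, K ⊆ (A ∪ LamP Γ u MeasLabel.X ∪ LamP Γ u MeasLabel.Y) ∩ {v | v ∉ Γ.I} ∧
      (K ∩ LamP Γ u MeasLabel.Y) \ A = (odd Γ.G (K ∪ {u}) ∩ LamP Γ u MeasLabel.Y) \ A ∧
      odd Γ.G (K ∪ {u}) \ (A ∪ LamP Γ u MeasLabel.Y ∪ LamP Γ u MeasLabel.Z) = ∅}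

end LOG


namespace LOG

variable {V : Type} [Fintype V]

theorem mem_odd_symmDiff (G : SimpleGraph V) (A B : Set V) (w : V) :
    w ∈ odd G (A ∆ B) ↔ ¬ (w ∈ odd G A ↔ w ∈ odd G B) := by
  classical
  have key : ∀ S T : Set V, (S ∆ T).ncard + 2 * (S ∩ T).ncard = S.ncard + T.ncard := by
    intro S T
    have h1 : (S ∆ T).ncard = (S \ T).ncard + (T \ S).ncard := by
      rw [Set.symmDiff_def]
      exact Set.ncard_union_eq disjoint_sdiff_sdiff (Set.toFinite _) (Set.toFinite _)
    have h2 := Set.ncard_inter_add_ncard_sdiff_eq_ncard S T (Set.toFinite _)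
    have h3 := Set.ncard_inter_add_ncard_sdiff_eq_ncard T S (Set.toFinite _)
    rw [Set.inter_comm T S] at h3
    omega
  have e : G.neighborSet w ∩ (A ∆ B) = (G.neighborSet w ∩ A) ∆ (G.neighborSet w ∩ B) :=
    Set.inter_symmDiff_distrib_left _ _ _
  have k := key (G.neighborSet w ∩ A) (G.neighborSet w ∩ B)
  simp only [odd, Set.mem_ofPred_eq, e, Nat.odd_iff]
  omega

theorem mem_symmDiff_iff (A B : Set V) (w : V) :
    w ∈ A ∆ B ↔ ¬ (w ∈ A ↔ w ∈ B) := by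
  rw [Set.mem_symmDiff]; tauto

/-- The flow conditions of a single measured vertex `u` with correction set `A`. -/
structure Good (Γ : LOG V) (prec : V → V → Prop) (u : V) (A : Set V) : Prop where
  psub : ∀ v ∈ A, v ∉ Γ.I
  pf1 : ∀ v ∈ A, u ≠ v → ¬ Γ.labIn v {MeasLabel.X, MeasLabel.Y} → prec u v
  pf2 : ∀ v ∈ odd Γ.G A, u ≠ v → ¬ Γ.labIn v {MeasLabel.Y, MeasLabel.Z} → prec u v
  pf3 : ∀ v, ¬ prec u v → u ≠ v → Γ.labIn v {MeasLabel.Y} → (v ∈ A ↔ v ∈ odd Γ.G A)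
  pf4 : Γ.lam u = MeasLabel.XY → u ∉ A ∧ u ∈ odd Γ.G A
  pf5 : Γ.lam u = MeasLabel.XZ → u ∈ A ∧ u ∈ odd Γ.G A
  pf6 : Γ.lam u = MeasLabel.YZ → u ∈ A ∧ u ∉ odd Γ.G A
  pf7 : Γ.lam u = MeasLabel.X → u ∈ odd Γ.G A
  pf8 : Γ.lam u = MeasLabel.Z → u ∈ A
  pf9 : Γ.lam u = MeasLabel.Y →
    ((u ∈ A ∧ u ∉ odd Γ.G A) ∨ (u ∉ A ∧ u ∈ odd Γ.G A))

/-- `w` violates the focussing condition for `A`. -/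
def Bad (Γ : LOG V) (A : Set V) (w : V) : Prop :=
  match Γ.lam w with
  | MeasLabel.XY => w ∈ odd Γ.G A
  | MeasLabel.X => w ∈ odd Γ.G A
  | MeasLabel.XZ => w ∈ A
  | MeasLabel.YZ => w ∈ A
  | MeasLabel.Z => w ∈ A
  | MeasLabel.Y => ¬ (w ∈ A ↔ w ∈ odd Γ.G A)

theorem bad_symmDiff (Γ : LOG V) (A B : Set V) (w : V) :
    Bad Γ (A ∆ B) w ↔ ¬ (Bad Γ A w ↔ Bad Γ B w) := by
  unfold Bad
  cases Γ.lam w <;> simp only [mem_odd_symmDiff, mem_symmDiff_iff] <;> tauto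

theorem Good.bad_self {Γ : LOG V} {prec : V → V → Prop} {u : V} {A : Set V}
    (h : Good Γ prec u A) : Bad Γ A u := by
  obtain ⟨-, -, -, -, h4, h5, h6, h7, h8, h9⟩ := h
  unfold Bad
  cases hl : Γ.lam u <;> simp only [hl, forall_const, reduceCtorEq, false_imp_iff] at * <;> tauto

theorem Good.prec_of_bad {Γ : LOG V} {prec : V → V → Prop} {u : V} {A : Set V}
    (h : Good Γ prec u A) {w : V} (hO : w ∉ Γ.O) (hne : u ≠ w) (hb : Bad Γ A w) :
    prec u w := by
  have h1 := h.pf1 w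
  have h2 := h.pf2 w
  have h3 := h.pf3 w
  unfold Bad at hb
  cases hl : Γ.lam w <;> simp [hl, labIn] at * <;> tauto

theorem Good.symmDiff {Γ : LOG V} {prec : V → V → Prop} {u v : V} {A B : Set V}
    (irrefl : ∀ a, ¬ prec a a) (trans : ∀ a b c, prec a b → prec b c → prec a c)
    (huO : u ∉ Γ.O) (huv : prec u v)
    (hA : Good Γ prec u A) (hB : Good Γ prec v B) : Good Γ prec u (A ∆ B) := by
  have hvu : ¬ prec v u := fun h => irrefl _ (trans _ _ _ huv h)
  have hne : v ≠ u := fun h => irrefl _ (h ▸ huv)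
  have h1 := hB.pf1 u
  have h2 := hB.pf2 u
  have h3 := hB.pf3 u hvu hne
  obtain ⟨a0, a1, a2, a3, a4, a5, a6, a7, a8, a9⟩ := hA
  refine ⟨?_, ?_, ?_, ?_, ?_, ?_, ?_, ?_, ?_, ?_⟩
  · intro x hx
    rcases hx with hx | hx
    · exact a0 x hx.1
    · exact hB.psub x hx.1
  · intro x hx hux hl
    rcases hx with hx | hx
    · exact a1 x hx.1 hux hl
    · by_cases hvx : v = x
      · exact hvx ▸ huv
      · exact trans _ _ _ huv (hB.pf1 x hx.1 hvx hl)
  · intro x hx hux hl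
    by_cases hxA : x ∈ odd Γ.G A
    · exact a2 x hxA hux hl
    · rw [mem_odd_symmDiff] at hx
      have hxB : x ∈ odd Γ.G B := by_contra fun hxB => hx (iff_of_false hxA hxB)
      by_cases hvx : v = x
      · exact hvx ▸ huv
      · exact trans _ _ _ huv (hB.pf2 x hxB hvx hl)
  · intro x hx hux hl
    have e1 := a3 x hx hux hl
    have e2 := hB.pf3 x (fun h => hx (trans _ _ _ huv h)) (fun h => hx (h ▸ huv)) hl
    rw [mem_odd_symmDiff, mem_symmDiff_iff, e1, e2]
  all_goals
    intro hl
    clear a0 a1 a2 a3 hB trans irrefl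
    simp only [mem_odd_symmDiff, mem_symmDiff_iff]
    simp [hl, labIn, huO, hne, hvu] at h1 h2 h3 a4 a5 a6 a7 a8 a9
    first
      | simp [h1, h2, a4]; done
      | simp [h1, h2, a5]; done
      | simp [h1, h2, a6]; done
      | simp [h1, h2, a7]; done
      | simp [h1, h2, a8]; done
      | tauto

theorem exists_focussed (Γ : LOG V) (p : V → Set V) (prec : V → V → Prop)
    (h : IsPauliFlow Γ p prec) (u : V) : u ∉ Γ.O →
    ∃ A, Good Γ prec u A ∧ ∀ w, w ∉ Γ.O → u ≠ w → ¬ Bad Γ A w := by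
  have wf : WellFounded (fun a b => prec b a) := by
    haveI : IsTrans V (fun a b => prec b a) := ⟨fun a b c hab hbc => h.trans _ _ _ hbc hab⟩
    haveI : Std.Irrefl (fun a b => prec b a) := ⟨fun a => h.irrefl a⟩
    exact Finite.wellFounded_of_trans_of_irrefl _
  induction u using wf.induction with
  | _ u ih =>
  intro huO
  have hne : {A | Good Γ prec u A}.Nonempty :=
    ⟨p u, h.psub u huO, h.pf1 u huO, h.pf2 u huO, h.pf3 u huO, h.pf4 u huO, h.pf5 u huO,
      h.pf6 u huO, h.pf7 u huO, h.pf8 u huO, h.pf9 u huO⟩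
  obtain ⟨A, hA, hmin⟩ := Set.exists_min_image {A | Good Γ prec u A}
    (fun A => {w | w ∉ Γ.O ∧ u ≠ w ∧ Bad Γ A w}.ncard) (Set.toFinite _) hne
  refine ⟨A, hA, fun w hwO huw hb => ?_⟩
  have hA' : Good Γ prec u A := hA
  have huw' := hA'.prec_of_bad hwO huw hb
  obtain ⟨B, hB, hBf⟩ := ih w huw' hwO
  have hlt := hmin (A ∆ B) (hA'.symmDiff h.irrefl h.trans huO huw' hB)
  refine absurd hlt (not_le.mpr (Set.ncard_lt_ncard ?_ (Set.toFinite _)))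
  refine (Set.ssubset_iff_of_subset ?_).mpr ⟨w, ⟨hwO, huw, hb⟩, ?_⟩
  · rintro x ⟨hxO, hux, hx⟩
    refine ⟨hxO, hux, ?_⟩
    by_cases hwx : w = x
    · exact hwx ▸ hb
    · have := hBf x hxO hwx
      rw [bad_symmDiff] at hx
      tauto
  · rintro ⟨-, -, hx⟩
    rw [bad_symmDiff] at hx
    have := hB.bad_self
    tauto

theorem exists_maxDelayed (Γ : LOG V) (h : ∃ p prec, IsPauliFlow Γ p prec) :
    ∃ p prec, IsMaxDelayed Γ p prec := by
  have wf : WellFounded (MoreDelayed : (V → V → Prop) → (V → V → Prop) → Prop) := by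
    haveI : IsTrans (V → V → Prop) MoreDelayed :=
      ⟨fun a b c hab hbc => ⟨fun k => (hbc.1 k).trans (hab.1 k), by
        obtain ⟨k, hk⟩ := hab.2
        exact ⟨k, (hbc.1 k).trans_lt hk⟩⟩⟩
    haveI : Std.Irrefl (MoreDelayed : (V → V → Prop) → (V → V → Prop) → Prop) :=
      ⟨fun a ha => by
        obtain ⟨k, hk⟩ := ha.2
        exact lt_irrefl _ hk⟩
    exact Finite.wellFounded_of_trans_of_irrefl _
  obtain ⟨p, prec, hp⟩ := h
  obtain ⟨r, ⟨q, hq⟩, hmin⟩ := wf.has_min {r | ∃ p, IsPauliFlow Γ p r} ⟨prec, p, hp⟩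
  exact ⟨q, r, hq, fun q' r' h' => hmin r' ⟨q', h'⟩⟩

end LOG

open LOG in
/-- a labelled open graph admitting a Pauli flow admits a maximally
delayed, focussed Pauli flow. -/
theorem exists_maxDelayed_focussed_pauliFlow {V : Type} [Fintype V] (Γ : LOG V)
    (h : ∃ p prec, IsPauliFlow Γ p prec) :
    ∃ p prec, IsMaxDelayed Γ p prec ∧ IsFocussed Γ p := by
  classical
  obtain ⟨p, prec, hp, hmax⟩ := exists_maxDelayed Γ h
  have hex := exists_focussed Γ p prec hp
  choose! q hq hf using hex
  refine ⟨q, prec, ⟨⟨hp.irrefl, hp.trans, fun u hu => (hq u hu).psub, fun u hu => (hq u hu).pf1,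
    fun u hu => (hq u hu).pf2, fun u hu => (hq u hu).pf3, fun u hu => (hq u hu).pf4,
    fun u hu => (hq u hu).pf5, fun u hu => (hq u hu).pf6, fun u hu => (hq u hu).pf7,
    fun u hu => (hq u hu).pf8, fun u hu => (hq u hu).pf9⟩, hmax⟩, ?_⟩
  intro v hv
  refine ⟨?_, ?_, ?_⟩
  · rintro w ⟨⟨hwO, hwv⟩, hw⟩
    have := hf v hv w hwO (fun e => hwv e.symm)
    unfold Bad at this
    cases hl : Γ.lam w <;> simp [hl] at this ⊢ <;> tauto
  · rintro w ⟨⟨hwO, hwv⟩, hw⟩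
    have := hf v hv w hwO (fun e => hwv e.symm)
    unfold Bad at this
    cases hl : Γ.lam w <;> simp [hl] at this ⊢ <;> tauto
  · rintro w ⟨hwO, hwv⟩ hl
    have := hf v hv w hwO (fun e => hwv e.symm)
    unfold Bad at this
    simp only [hl] at this
    tauto
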